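/- arXiv:1611.05467 — 5 statements merged into one kernel-verified Lean document; each statement's English description precedes it below -/
import Mathlib

section
/- Let (A₁,A₂,U,V) ~ q be jointly distributed random variables on finite sets whose support factorizes as supp(A₁,A₂,U,V) = supp(A₁,A₂) × supp(U,V). Then GK^{A₁U,A₂V} ≡ (GK^{A₁,A₂}, GK^{U,V}); that is, the Gács–Körner common randomness of the pair ((A₁,U),(A₂,V)) and the pair consisting of the Gács–Körner common randomness of (A₁,A₂) together with that of (U,V) are each almost surely a deterministic function of the other. -/
open Finset

namespace CRR

open scoped Classical

variable {Ω α β γ : Type*}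

/-- A probability mass function on a finite type, given as a function. -/
def IsPMF [Fintype Ω] (p : Ω → ℝ) : Prop := (∀ ω, 0 ≤ p ω) ∧ ∑ ω, p ω = 1

/-- Pushforward pmf: the pmf of the random variable `X` when the outcome is drawn from `p`. -/
noncomputable def push [Fintype Ω] (p : Ω → ℝ) (X : Ω → α) (a : α) : ℝ :=
  ∑ ω, if X ω = a then p ω else 0

/-- Shannon entropy (base 2) of a pmf, with the convention 0·log 0 = 0. -/
noncomputable def ent [Fintype α] (q : α → ℝ) : ℝ := -∑ a, q a * Real.logb 2 (q a)

/-- Entropy of a random variable `X` under `p`. -/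
noncomputable def entRV [Fintype Ω] [Fintype α] (p : Ω → ℝ) (X : Ω → α) : ℝ := ent (push p X)

/-- Conditional entropy H(X|Y) under `p`. -/
noncomputable def condEntRV [Fintype Ω] [Fintype α] [Fintype β] (p : Ω → ℝ)
    (X : Ω → α) (Y : Ω → β) : ℝ :=
  entRV p (fun ω => (X ω, Y ω)) - entRV p Y

/-- Conditional mutual information I(X;Y|Z) under `p`. -/
noncomputable def condMI [Fintype Ω] [Fintype α] [Fintype β] [Fintype γ] (p : Ω → ℝ)
    (X : Ω → α) (Y : Ω → β) (Z : Ω → γ) : ℝ :=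
  entRV p (fun ω => (X ω, Z ω)) + entRV p (fun ω => (Y ω, Z ω)) -
    entRV p (fun ω => (X ω, Y ω, Z ω)) - entRV p Z

/-- Markov chain X – Y – Z : X and Z are conditionally independent given Y, under `p`. -/
def MarkovChain [Fintype Ω] (p : Ω → ℝ) (X : Ω → α) (Y : Ω → β) (Z : Ω → γ) : Prop :=
  ∀ x y z, push p (fun ω => (X ω, Y ω, Z ω)) (x, y, z) * push p Y y =
    push p (fun ω => (X ω, Y ω)) (x, y) * push p (fun ω => (Z ω, Y ω)) (z, y)

/-- One step between right nodes of the bipartite graph G^{X,Y}: they share a left neighbour. -/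
def GKStep (p : α × β → ℝ) (y₁ y₂ : β) : Prop := ∃ x, 0 < p (x, y₁) ∧ 0 < p (x, y₂)

/-- y₁ ⇌ y₂ : y₁ and y₂ lie in the same connected component of G^{X,Y}. -/
def GKConn (p : α × β → ℝ) : β → β → Prop := Relation.ReflTransGen (GKStep p)

/-- `g` is a Gács–Körner mapping for the joint pmf `p`. -/
def IsGKMap (p : α × β → ℝ) (g : β → β) : Prop := ∀ y₁ y₂, (g y₁ = g y₂ ↔ GKConn p y₁ y₂)

/-- Expectation of `f` under pmf `p`. -/
noncomputable def expVal [Fintype Ω] (p : Ω → ℝ) (f : Ω → ℝ) : ℝ := ∑ ω, p ω * f ω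

/-- On finitely many outcomes, a pmf pushed forward along `X` is positive at `a` exactly when some
outcome of positive mass is sent to `a`. -/
theorem push_pos_iff [Fintype Ω] {p : Ω → ℝ} (hp : ∀ ω, 0 ≤ p ω) (X : Ω → α) (a : α) :
    0 < push p X a ↔ ∃ ω, X ω = a ∧ 0 < p ω := by
  have hnonneg : ∀ ω ∈ univ, 0 ≤ if X ω = a then p ω else 0 := fun ω _ => by
    split_ifs
    exacts [hp ω, le_rfl]
  rw [push, Finset.sum_pos_iff_of_nonneg hnonneg]
  refine exists_congr fun ω => ?_
  by_cases h : X ω = a <;> simp [h]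

/-- If `h` is constant on the fibres of `f` within `s`, then `h` is a function of `f` on `s`. -/
theorem exists_factor {s : Ω → Prop} {f h : Ω → α}
    (H : ∀ x y, s x → s y → f x = f y → h x = h y) :
    ∃ φ : α → α, ∀ x, s x → φ (f x) = h x := by
  refine ⟨fun c => if hc : ∃ x, s x ∧ f x = c then h hc.choose else c, fun x hx => ?_⟩
  have hc : ∃ y, s y ∧ f y = f x := ⟨x, hx, rfl⟩
  simp only [dif_pos hc]
  exact H _ _ hc.choose_spec.1 hx hc.choose_spec.2

section ProductSupport

variable {δ : Type*} {p : α × β → ℝ} {r : γ × δ → ℝ} {j : (α × γ) × (β × δ) → ℝ}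

theorem GKConn.fst_snd (hj : ∀ a b c d, 0 < j ((a, c), (b, d)) ↔ 0 < p (a, b) ∧ 0 < r (c, d))
    {y z : β × δ} (h : GKConn j y z) : GKConn p y.1 z.1 ∧ GKConn r y.2 z.2 := by
  refine ⟨Relation.ReflTransGen.lift Prod.fst ?_ _ _ h,
    Relation.ReflTransGen.lift Prod.snd ?_ _ _ h⟩ <;>
  · rintro ⟨b, d⟩ ⟨b', d'⟩ ⟨⟨a, c⟩, h₁, h₂⟩
    rw [hj] at h₁ h₂
    first
    | exact ⟨a, h₁.1, h₂.1⟩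
    | exact ⟨c, h₁.2, h₂.2⟩

theorem GKConn.prodMk (hj : ∀ a b c d, 0 < j ((a, c), (b, d)) ↔ 0 < p (a, b) ∧ 0 < r (c, d))
    {b b' : β} {d d' : δ} (hb : GKConn p b b') (hd : GKConn r d d')
    (hb' : ∃ a, 0 < p (a, b')) (hd₀ : ∃ c, 0 < r (c, d)) : GKConn j (b, d) (b', d') := by
  obtain ⟨a, ha⟩ := hb'
  obtain ⟨c, hc⟩ := hd₀
  have h₁ : GKConn j (b, d) (b', d) :=
    Relation.ReflTransGen.lift (fun x => (x, d))
      (fun _ _ ⟨a, h₁, h₂⟩ => ⟨(a, c), (hj ..).2 ⟨h₁, hc⟩, (hj ..).2 ⟨h₂, hc⟩⟩) _ _ hb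
  have h₂ : GKConn j (b', d) (b', d') :=
    Relation.ReflTransGen.lift (fun x => (b', x))
      (fun _ _ ⟨c, h₁, h₂⟩ => ⟨(a, c), (hj ..).2 ⟨ha, h₁⟩, (hj ..).2 ⟨ha, h₂⟩⟩) _ _ hd
  exact Relation.ReflTransGen.trans h₁ h₂

end ProductSupport

/-- Lemma 1: if supp(A₁,A₂,U,V) = supp(A₁,A₂) × supp(U,V), then
GK^{A₁U,A₂V} ≡ (GK^{A₁,A₂}, GK^{U,V}): each is a.s. a function of the other. -/
theorem stmt0 {A₁ A₂ U V : Type*} [Fintype A₁] [Fintype A₂] [Fintype U] [Fintype V]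
    (q : A₁ × A₂ × U × V → ℝ) (hq : IsPMF q)
    (hsupp : ∀ a₁ a₂ u v, 0 < q (a₁, a₂, u, v) ↔
      (0 < push q (fun x => (x.1, x.2.1)) (a₁, a₂) ∧
        0 < push q (fun x => (x.2.2.1, x.2.2.2)) (u, v)))
    (g₁ : A₂ × V → A₂ × V)
    (hg₁ : IsGKMap (push q (fun x => ((x.1, x.2.2.1), (x.2.1, x.2.2.2)))) g₁)
    (g₂ : A₂ → A₂) (hg₂ : IsGKMap (push q (fun x => (x.1, x.2.1))) g₂)
    (g₃ : V → V) (hg₃ : IsGKMap (push q (fun x => (x.2.2.1, x.2.2.2))) g₃) :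
    (∃ φ : A₂ × V → A₂ × V, ∀ x : A₁ × A₂ × U × V, 0 < q x →
        φ (g₂ x.2.1, g₃ x.2.2.2) = g₁ (x.2.1, x.2.2.2)) ∧
    (∃ ψ : A₂ × V → A₂ × V, ∀ x : A₁ × A₂ × U × V, 0 < q x →
        ψ (g₁ (x.2.1, x.2.2.2)) = (g₂ x.2.1, g₃ x.2.2.2)) := by
  have hj : ∀ a b c d, 0 < push q (fun x => ((x.1, x.2.2.1), (x.2.1, x.2.2.2))) ((a, c), (b, d)) ↔
      0 < push q (fun x => (x.1, x.2.1)) (a, b) ∧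
        0 < push q (fun x => (x.2.2.1, x.2.2.2)) (c, d) := by
    intro a b c d
    rw [← hsupp, push_pos_iff hq.1]
    constructor
    · rintro ⟨⟨a, b, c, d⟩, h, hpos⟩
      simp only [Prod.mk.injEq] at h
      obtain ⟨⟨rfl, rfl⟩, rfl, rfl⟩ := h
      exact hpos
    · exact fun h => ⟨(a, b, c, d), rfl, h⟩
  constructor
  · refine exists_factor (f := fun x : A₁ × A₂ × U × V => (g₂ x.2.1, g₃ x.2.2.2))
      (h := fun x => g₁ (x.2.1, x.2.2.2)) ?_
    rintro ⟨a, b, c, d⟩ ⟨a', b', c', d'⟩ hx hy h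
    obtain ⟨hb, hd⟩ := Prod.mk.inj h
    exact (hg₁ _ _).2 (GKConn.prodMk hj ((hg₂ _ _).1 hb) ((hg₃ _ _).1 hd)
      ⟨a', ((hsupp ..).1 hy).1⟩ ⟨c, ((hsupp ..).1 hx).2⟩)
  · refine exists_factor (f := fun x : A₁ × A₂ × U × V => g₁ (x.2.1, x.2.2.2))
      (h := fun x => (g₂ x.2.1, g₃ x.2.2.2)) ?_
    intro x y _ _ h
    obtain ⟨hb, hd⟩ := GKConn.fst_snd hj ((hg₁ _ _).1 h)
    exact Prod.ext ((hg₂ _ _).2 hb) ((hg₃ _ _).2 hd)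

end CRR
end

section
/- Let (X,Y,Z) ~ q be jointly distributed random variables on finite sets with supp(X,Y,Z) = supp(X,Y) × supp(Z). Then GK^{X,(Y,Z)} ≡ GK^{X,Y}; that is, the Gács–Körner common randomness of the pair (X,(Y,Z)) and the Gács–Körner common randomness of (X,Y) are each almost surely a deterministic function of the other. -/
open Finset

namespace CRR

open scoped Classical

variable {Ω α β γ : Type*}

/-- If the support of `q` is a product of the support of `(X, Y)` and that of `Z`, a path between
right nodes of the graph of `(X, Y)` starting in the support lifts to the graph of `(X, (Y, Z))`. -/
theorem GKConn.lift_prod {p : α × β → ℝ} {r : γ → ℝ} {q : α × β × γ → ℝ}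
    (hsupp : ∀ x y z, 0 < q (x, y, z) ↔ 0 < p (x, y) ∧ 0 < r z)
    {x : α} {y₁ y₂ : β} {z₁ z₂ : γ} (hx : 0 < p (x, y₁)) (hz₁ : 0 < r z₁) (hz₂ : 0 < r z₂)
    (h : GKConn p y₁ y₂) : GKConn q (y₁, z₁) (y₂, z₂) := by
  induction h with
  | refl => exact .single ⟨x, (hsupp _ _ _).2 ⟨hx, hz₁⟩, (hsupp _ _ _).2 ⟨hx, hz₂⟩⟩
  | tail _ hstep ih =>
    obtain ⟨x', h₁, h₂⟩ := hstep
    exact ih.tail ⟨x', (hsupp _ _ _).2 ⟨h₁, hz₂⟩, (hsupp _ _ _).2 ⟨h₂, hz₂⟩⟩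

/-- Paths in the graph of `(X, (Y, Z))` project to paths in the graph of `(X, Y)`. -/
theorem GKConn.fst {p : α × β → ℝ} {q : α × β × γ → ℝ}
    (hpos : ∀ x y z, 0 < q (x, y, z) → 0 < p (x, y)) {u v : β × γ}
    (h : GKConn q u v) : GKConn p u.1 v.1 :=
  Relation.ReflTransGen.lift Prod.fst
    (fun _ _ ⟨x, h₁, h₂⟩ => ⟨x, hpos _ _ _ h₁, hpos _ _ _ h₂⟩) _ _ h

/-- A function determined by another one on a set is a function of it there. -/
theorem exists_comp_eq_of_forall {P : Ω → Prop} [Nonempty β] {f : Ω → α} {g : Ω → β}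
    (h : ∀ u v, P u → P v → f u = f v → g u = g v) :
    ∃ φ : α → β, ∀ w, P w → φ (f w) = g w := by
  obtain ⟨φ, hφ⟩ := (Function.factorsThrough_iff (f := fun w : {w // P w} => f w)
    (fun w : {w // P w} => g w)).1 fun u v huv => h u v u.2 v.2 huv
  exact ⟨φ, fun w hw => (congrFun hφ ⟨w, hw⟩).symm⟩

/-- Lemma 2: if supp(X,Y,Z) = supp(X,Y) × supp(Z), then
GK^{X,(Y,Z)} ≡ GK^{X,Y}: each is a.s. a function of the other. -/
theorem stmt1 {X Y Z : Type*} [Fintype X] [Fintype Y] [Fintype Z]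
    (q : X × Y × Z → ℝ) (hq : IsPMF q)
    (hsupp : ∀ x y z, 0 < q (x, y, z) ↔
      (0 < push q (fun w => (w.1, w.2.1)) (x, y) ∧ 0 < push q (fun w => w.2.2) z))
    (g : Y × Z → Y × Z) (hg : IsGKMap q g)
    (g' : Y → Y) (hg' : IsGKMap (push q (fun w => (w.1, w.2.1))) g') :
    (∃ φ : Y → Y × Z, ∀ w : X × Y × Z, 0 < q w → φ (g' w.2.1) = g w.2) ∧
    (∃ ψ : Y × Z → Y, ∀ w : X × Y × Z, 0 < q w → ψ (g w.2) = g' w.2.1) := by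
  have hne : Nonempty (X × Y × Z) := by
    by_contra hempty
    rw [not_nonempty_iff] at hempty
    exact zero_ne_one (Fintype.sum_empty q ▸ hq.2)
  obtain ⟨_, y, z⟩ := hne
  have : Nonempty Y := ⟨y⟩
  have : Nonempty Z := ⟨z⟩
  refine ⟨exists_comp_eq_of_forall fun u v hu hv huv => ?_,
    exists_comp_eq_of_forall fun u v _ _ huv => ?_⟩
  · obtain ⟨hu₁, hu₂⟩ := (hsupp _ _ _).1 hu
    obtain ⟨_, hv₂⟩ := (hsupp _ _ _).1 hv
    exact (hg _ _).2 (((hg' _ _).1 huv).lift_prod hsupp hu₁ hu₂ hv₂)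
  · exact (hg' _ _).2 (((hg _ _).1 huv).fst fun _ _ _ h => ((hsupp _ _ _).1 h).1)

end CRR
end

section
/- For every k ∈ ℕ and every D ≥ 0, the rate region ℛ†_k(D) is a subset of ℛ‡_k(D). -/
open Finset

namespace CRR

open scoped Classical

variable {Ω α β γ : Type*}

section RateRegions

variable {S U V W : Type*} [Fintype S] [Fintype U] [Fintype V] [Fintype W]

/-- The class 𝒫*_{D,k}: joint pmfs q on (Fin k) × S × U × V (auxiliary alphabet of size k)
with the required marginal, Markov chain A – S – (U,V), and a reconstruction function of the
Gács–Körner common randomness GK^{AU,AV} meeting distortion D. -/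
def PStar (p : S × U × V → ℝ) (d : S → W → ℝ) (D : ℝ) (k : ℕ)
    (q : Fin k × S × U × V → ℝ) : Prop :=
  IsPMF q ∧ (∀ y, push q (fun x => x.2) y = p y) ∧
    MarkovChain q (fun x => x.1) (fun x => x.2.1) (fun x => x.2.2) ∧
    ∃ (g : Fin k × V → Fin k × V) (f : Fin k × V → W),
      IsGKMap (push q (fun x => ((x.1, x.2.2.1), (x.1, x.2.2.2)))) g ∧
      expVal q (fun x => d x.2.1 (f (g (x.1, x.2.2.2)))) ≤ D

/-- The rate region ℛ*_k(D). -/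
def RStar (p : S × U × V → ℝ) (d : S → W → ℝ) (D : ℝ) (k : ℕ) : Set (ℝ × ℝ) :=
  {r : ℝ × ℝ | 0 ≤ r.1 ∧ 0 ≤ r.2 ∧ ∃ q : Fin k × S × U × V → ℝ, PStar p d D k q ∧
    condMI q (fun x => x.2.1) (fun x => x.1) (fun x => x.2.2.1) ≤ r.1 ∧
    condMI q (fun x => x.2.1) (fun x => x.1) (fun x => x.2.2.2) ≤ r.2 + r.1}

/-- The class 𝒫‡_{D,k}: joint pmfs q on (Fin k × Fin k × Fin k) × S × U × V
(coordinates (A,B,C,S,U,V)) with marginal p, Markov chain (A,B,C) – S – (U,V) and a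
reconstruction function of GK^{ABU,ACV} meeting distortion D. -/
def PDdag (p : S × U × V → ℝ) (d : S → W → ℝ) (D : ℝ) (k : ℕ)
    (q : (Fin k × Fin k × Fin k) × S × U × V → ℝ) : Prop :=
  IsPMF q ∧ (∀ y, push q (fun x => x.2) y = p y) ∧
    MarkovChain q (fun x => x.1) (fun x => x.2.1) (fun x => x.2.2) ∧
    ∃ (g : Fin k × Fin k × V → Fin k × Fin k × V) (f : Fin k × Fin k × V → W),
      IsGKMap (push q (fun x => ((x.1.1, x.1.2.1, x.2.2.1), (x.1.1, x.1.2.2, x.2.2.2)))) g ∧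
      expVal q (fun x => d x.2.1 (f (g (x.1.1, x.1.2.2, x.2.2.2)))) ≤ D

/-- The rate region ℛ‡_k(D). -/
def RDdag (p : S × U × V → ℝ) (d : S → W → ℝ) (D : ℝ) (k : ℕ) : Set (ℝ × ℝ) :=
  {r : ℝ × ℝ | 0 ≤ r.1 ∧ 0 ≤ r.2 ∧
    ∃ q : (Fin k × Fin k × Fin k) × S × U × V → ℝ, PDdag p d D k q ∧
    condMI q (fun x => x.2.1) (fun x => (x.1.1, x.1.2.1)) (fun x => x.2.2.1) ≤ r.1 ∧
    condMI q (fun x => x.2.1) (fun x => x.1.2.1) (fun x => (x.1.1, x.1.2.2, x.2.2)) +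
      condMI q (fun x => x.2.1) (fun x => (x.1.1, x.1.2.2)) (fun x => x.2.2.2) ≤ r.2 + r.1}

/-- The class 𝒫†_{D,k}: members of 𝒫‡_{D,k} with additionally B – (A,S) – C. -/
def PDag (p : S × U × V → ℝ) (d : S → W → ℝ) (D : ℝ) (k : ℕ)
    (q : (Fin k × Fin k × Fin k) × S × U × V → ℝ) : Prop :=
  PDdag p d D k q ∧
    MarkovChain q (fun x => x.1.2.1) (fun x => (x.1.1, x.2.1)) (fun x => x.1.2.2)

/-- The rate region ℛ†_k(D). -/
def RDag (p : S × U × V → ℝ) (d : S → W → ℝ) (D : ℝ) (k : ℕ) : Set (ℝ × ℝ) :=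
  {r : ℝ × ℝ | 0 ≤ r.1 ∧ 0 ≤ r.2 ∧
    ∃ q : (Fin k × Fin k × Fin k) × S × U × V → ℝ, PDag p d D k q ∧
    condMI q (fun x => x.2.1) (fun x => (x.1.1, x.1.2.1)) (fun x => x.2.2.1) ≤ r.1 ∧
    max (condMI q (fun x => x.2.1) (fun x => x.1.1) (fun x => x.2.2.1))
        (condMI q (fun x => x.2.1) (fun x => x.1.1) (fun x => x.2.2.2)) +
      condMI q (fun x => x.2.1) (fun x => x.1.2.1) (fun x => (x.1.1, x.2.2.1)) +
      condMI q (fun x => x.2.1) (fun x => x.1.2.2) (fun x => (x.1.1, x.2.2.2)) ≤ r.2 + r.1}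

end RateRegions

theorem push_nonneg [Fintype Ω] {p : Ω → ℝ} (hp : ∀ ω, 0 ≤ p ω) (X : Ω → α) (a : α) :
    0 ≤ push p X a :=
  Finset.sum_nonneg fun ω _ => by split_ifs <;> simp [hp ω]

theorem push_apply_pos [Fintype Ω] {p : Ω → ℝ} (hp : ∀ ω, 0 ≤ p ω) (X : Ω → α) {ω : Ω}
    (hω : 0 < p ω) : 0 < push p X (X ω) := by
  refine Finset.sum_pos' (fun ω' _ => ?_) ⟨ω, Finset.mem_univ _, by simpa using hω⟩
  split_ifs <;> simp [hp ω']

/-- The law of the unconscious statistician for finite pmfs. -/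
theorem sum_push_mul [Fintype Ω] [Fintype α] (p : Ω → ℝ) (X : Ω → α) (g : α → ℝ) :
    ∑ a, push p X a * g a = ∑ ω, p ω * g (X ω) := by
  simp only [push, Finset.sum_mul, ite_mul, zero_mul]
  rw [Finset.sum_comm]
  simp

theorem sum_push_prodMk [Fintype Ω] [Fintype α] (p : Ω → ℝ) (X : Ω → α) (Z : Ω → γ) (z : γ) :
    ∑ x, push p (fun ω => (X ω, Z ω)) (x, z) = push p Z z := by
  simp only [push, Prod.mk.injEq, ite_and]
  rw [Finset.sum_comm]
  simp

theorem entRV_eq_sum [Fintype Ω] [Fintype α] (p : Ω → ℝ) (X : Ω → α) :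
    entRV p X = -∑ ω, p ω * Real.logb 2 (push p X (X ω)) := by
  rw [entRV, ent, sum_push_mul p X fun a => Real.logb 2 (push p X a)]

/-- Entropy depends only on the partition of the sample space induced by the random variable. -/
theorem entRV_congr [Fintype Ω] [Fintype α] [Fintype β] (p : Ω → ℝ) {X : Ω → α} {Y : Ω → β}
    (h : ∀ ω ω', X ω = X ω' ↔ Y ω = Y ω') : entRV p X = entRV p Y := by
  simp only [entRV_eq_sum, push, h]

theorem condMI_eq_sum [Fintype Ω] [Fintype α] [Fintype β] [Fintype γ] (p : Ω → ℝ)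
    (X : Ω → α) (Y : Ω → β) (Z : Ω → γ) :
    condMI p X Y Z = ∑ ω, p ω *
      (Real.logb 2 (push p (fun ω => (X ω, Y ω, Z ω)) (X ω, Y ω, Z ω)) +
        Real.logb 2 (push p Z (Z ω)) -
        (Real.logb 2 (push p (fun ω => (X ω, Z ω)) (X ω, Z ω)) +
        Real.logb 2 (push p (fun ω => (Y ω, Z ω)) (Y ω, Z ω)))) := by
  simp only [condMI, entRV_eq_sum, mul_sub, mul_add, Finset.sum_sub_distrib,
    Finset.sum_add_distrib]
  ring

theorem condMI_nonneg [Fintype Ω] [Fintype α] [Fintype β] [Fintype γ] {p : Ω → ℝ}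
    (hp : ∀ ω, 0 ≤ p ω) (X : Ω → α) (Y : Ω → β) (Z : Ω → γ) : 0 ≤ condMI p X Y Z := by
  let T : Ω → α × β × γ := fun ω => (X ω, Y ω, Z ω)
  let P : α × γ → ℝ := push p fun ω => (X ω, Z ω)
  let Q : β × γ → ℝ := push p fun ω => (Y ω, Z ω)
  let r : α × β × γ → ℝ := fun t => P (t.1, t.2.2) * Q t.2 / push p Z t.2.2
  have hr : ∀ t, 0 ≤ r t := fun t => div_nonneg
    (mul_nonneg (push_nonneg hp _ _) (push_nonneg hp _ _)) (push_nonneg hp _ _)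
  have hr_sum : ∑ t, r t = ∑ ω, p ω := by
    calc ∑ t, r t = ∑ z, (∑ x, P (x, z)) * (∑ y, Q (y, z)) / push p Z z := by
          simp only [r, Fintype.sum_prod_type]
          simp only [Finset.sum_comm (s := (Finset.univ : Finset β)) (t := (Finset.univ : Finset γ))]
          rw [Finset.sum_comm]
          refine Finset.sum_congr rfl fun z _ => ?_
          rw [Finset.sum_mul_sum, Finset.sum_div]
          exact Finset.sum_congr rfl fun x _ => by rw [Finset.sum_div]
      _ = ∑ z, push p Z z := by
          refine Finset.sum_congr rfl fun z _ => ?_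
          rw [sum_push_prodMk, sum_push_prodMk, mul_self_div_self]
      _ = ∑ ω, p ω := by simpa using sum_push_mul p Z fun _ => 1
  have hratio : ∑ ω, p ω * (r (T ω) / push p T (T ω)) ≤ ∑ ω, p ω := by
    rw [← hr_sum, ← sum_push_mul p T fun t => r t / push p T t]
    refine Finset.sum_le_sum fun t _ => ?_
    rcases eq_or_ne (push p T t) 0 with h | h
    · simpa [h] using hr t
    · rw [mul_div_cancel₀ _ h]
  have hlog : 0 < Real.log 2 := Real.log_pos one_lt_two
  have hterm : ∀ ω, p ω * ((1 - r (T ω) / push p T (T ω)) / Real.log 2) ≤ p ω *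
      (Real.logb 2 (push p T (T ω)) + Real.logb 2 (push p Z (Z ω)) -
        (Real.logb 2 (P (X ω, Z ω)) + Real.logb 2 (Q (Y ω, Z ω)))) := by
    intro ω
    rcases (hp ω).eq_or_lt with h | h
    · simp [← h]
    have hT := push_apply_pos hp T h
    have hZ := push_apply_pos hp Z h
    have hP : 0 < P (X ω, Z ω) := push_apply_pos hp (fun ω => (X ω, Z ω)) h
    have hQ : 0 < Q (Y ω, Z ω) := push_apply_pos hp (fun ω => (Y ω, Z ω)) h
    have hR : 0 < r (T ω) := div_pos (mul_pos hP hQ) hZ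
    have hlogR : Real.log (r (T ω)) = Real.log (P (X ω, Z ω)) + Real.log (Q (Y ω, Z ω)) -
        Real.log (push p Z (Z ω)) := by
      rw [← Real.log_mul hP.ne' hQ.ne', ← Real.log_div (mul_pos hP hQ).ne' hZ.ne']
    have hle := Real.log_le_sub_one_of_pos (div_pos hR hT)
    rw [Real.log_div hR.ne' hT.ne', hlogR] at hle
    refine mul_le_mul_of_nonneg_left ?_ h.le
    simp only [Real.logb, ← add_div, ← sub_div]
    exact div_le_div_of_nonneg_right (by linarith) hlog.le
  rw [condMI_eq_sum]
  refine le_trans ?_ (Finset.sum_le_sum fun ω _ => hterm ω)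
  simp only [← mul_div_assoc, ← Finset.sum_div, mul_sub, mul_one, Finset.sum_sub_distrib]
  refine div_nonneg ?_ hlog.le
  simp only [mul_div_assoc]
  exact sub_nonneg.2 hratio

theorem MarkovChain.condMI_eq_zero [Fintype Ω] [Fintype α] [Fintype β] [Fintype γ] {p : Ω → ℝ}
    (hp : ∀ ω, 0 ≤ p ω) {X : Ω → α} {Y : Ω → β} {Z : Ω → γ} (h : MarkovChain p X Y Z) :
    condMI p X Z Y = 0 := by
  rw [condMI_eq_sum]
  refine Finset.sum_eq_zero fun ω _ => ?_
  rcases (hp ω).eq_or_lt with h0 | h0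
  · simp [← h0]
  have hswap : push p (fun ω => (X ω, Z ω, Y ω)) (X ω, Z ω, Y ω) =
      push p (fun ω => (X ω, Y ω, Z ω)) (X ω, Y ω, Z ω) := by
    simp only [push, Prod.mk.injEq, and_comm]
  rw [hswap, ← Real.logb_mul (push_apply_pos hp (fun ω => (X ω, Y ω, Z ω)) h0).ne'
      (push_apply_pos hp Y h0).ne', h,
    Real.logb_mul (push_apply_pos hp (fun ω => (X ω, Y ω)) h0).ne'
      (push_apply_pos hp (fun ω => (Z ω, Y ω)) h0).ne', sub_self, mul_zero]

section SideInformation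

variable {A B C S U V : Type*} [Fintype Ω] [Fintype A] [Fintype B] [Fintype C] [Fintype S]
  [Fintype U] [Fintype V] {p : Ω → ℝ} (a : Ω → A) (b : Ω → B) (c : Ω → C) (s : Ω → S)
  (u : Ω → U) (v : Ω → V)

/-- Chain rule for conditional mutual information. -/
theorem condMI_prodMk :
    condMI p s (fun ω => (a ω, c ω)) v =
      condMI p s a v + condMI p s c (fun ω => (a ω, v ω)) := by
  have e₁ : entRV p (fun ω => ((a ω, c ω), v ω)) = entRV p (fun ω => (c ω, a ω, v ω)) :=
    entRV_congr p fun _ _ => by simp only [Prod.mk.injEq]; tauto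
  have e₂ : entRV p (fun ω => (s ω, (a ω, c ω), v ω)) =
      entRV p (fun ω => (s ω, c ω, a ω, v ω)) :=
    entRV_congr p fun _ _ => by simp only [Prod.mk.injEq]; tauto
  simp only [condMI, e₁, e₂]
  ring

/-- If `B – (A,S) – C` and `(A,B,C) – S – (U,V)`, then `I(S;B|A,C,U,V) ≤ I(S;B|A,U)`. -/
theorem condMI_le_of_markovChain (hp : ∀ ω, 0 ≤ p ω)
    (h₁ : MarkovChain p (fun ω => (a ω, b ω, c ω)) s (fun ω => (u ω, v ω)))
    (h₂ : MarkovChain p b (fun ω => (a ω, s ω)) c) :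
    condMI p s b (fun ω => (a ω, c ω, u ω, v ω)) ≤ condMI p s b (fun ω => (a ω, u ω)) := by
  have m₁ := h₁.condMI_eq_zero hp
  have m₂ := h₂.condMI_eq_zero hp
  have i₁ := condMI_nonneg hp b (fun ω => (c ω, v ω)) (fun ω => (a ω, u ω))
  have i₂ := condMI_nonneg hp (fun ω => (a ω, c ω)) (fun ω => (u ω, v ω)) s
  have i₃ := condMI_nonneg hp b u (fun ω => (a ω, s ω))
  have e₁ : entRV p (fun ω => ((c ω, v ω), a ω, u ω)) = entRV p (fun ω => (a ω, c ω, u ω, v ω)) :=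
    entRV_congr p fun _ _ => by simp only [Prod.mk.injEq]; tauto
  have e₂ : entRV p (fun ω => (b ω, (c ω, v ω), a ω, u ω)) =
      entRV p (fun ω => (b ω, a ω, c ω, u ω, v ω)) :=
    entRV_congr p fun _ _ => by simp only [Prod.mk.injEq]; tauto
  have e₃ : entRV p (fun ω => ((a ω, c ω), (u ω, v ω), s ω)) =
      entRV p (fun ω => (s ω, a ω, c ω, u ω, v ω)) :=
    entRV_congr p fun _ _ => by simp only [Prod.mk.injEq]; tauto
  have e₄ : entRV p (fun ω => ((a ω, b ω, c ω), (u ω, v ω), s ω)) =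
      entRV p (fun ω => (s ω, b ω, a ω, c ω, u ω, v ω)) :=
    entRV_congr p fun _ _ => by simp only [Prod.mk.injEq]; tauto
  have e₅ : entRV p (fun ω => ((a ω, b ω, c ω), s ω)) = entRV p (fun ω => (b ω, c ω, a ω, s ω)) :=
    entRV_congr p fun _ _ => by simp only [Prod.mk.injEq]; tauto
  have e₆ : entRV p (fun ω => ((a ω, c ω), s ω)) = entRV p (fun ω => (c ω, a ω, s ω)) :=
    entRV_congr p fun _ _ => by simp only [Prod.mk.injEq]; tauto
  have e₇ : entRV p (fun ω => (u ω, a ω, s ω)) = entRV p (fun ω => (s ω, a ω, u ω)) :=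
    entRV_congr p fun _ _ => by simp only [Prod.mk.injEq]; tauto
  have e₈ : entRV p (fun ω => (b ω, u ω, a ω, s ω)) = entRV p (fun ω => (s ω, b ω, a ω, u ω)) :=
    entRV_congr p fun _ _ => by simp only [Prod.mk.injEq]; tauto
  simp only [condMI] at *
  linarith

end SideInformation

/-- Lemma 4: ℛ†_k(D) ⊆ ℛ‡_k(D) for every k and D ≥ 0. -/
theorem stmt4 {S U V W : Type*} [Fintype S] [Fintype U] [Fintype V] [Fintype W]
    (p : S × U × V → ℝ) (hp : IsPMF p) (Dbar : ℝ) (hDbar : 0 < Dbar)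
    (d : S → W → ℝ) (hd : ∀ s w, 0 ≤ d s w ∧ d s w ≤ Dbar)
    (k : ℕ) (D : ℝ) (hD : 0 ≤ D) :
    RDag p d D k ⊆ RDdag p d D k := by
  rintro r ⟨h₁, h₂, q, ⟨hq, hM⟩, hr, hsum⟩
  refine ⟨h₁, h₂, q, hq, hr, ?_⟩
  have hle := condMI_le_of_markovChain (p := q) (fun x => x.1.1) (fun x => x.1.2.1)
    (fun x => x.1.2.2) (fun x => x.2.1) (fun x => x.2.2.1) (fun x => x.2.2.2) hq.1.1 hq.2.2.1 hM
  have hchain := condMI_prodMk (p := q) (fun x => x.1.1) (fun x => x.1.2.2) (fun x => x.2.1)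
    (fun x => x.2.2.2)
  have hmax := le_max_right (condMI q (fun x => x.2.1) (fun x => x.1.1) (fun x => x.2.2.1))
    (condMI q (fun x => x.2.1) (fun x => x.1.1) (fun x => x.2.2.2))
  linarith

end CRR
end

section
/- For every D ≥ 0, the rate region ℛ*(D) = ∪_{k∈ℕ} ℛ*_k(D) is a convex subset of [0,∞)². -/
open Finset

namespace CRR

open scoped Classical

variable {Ω α β γ : Type*}

section Push

variable [Fintype Ω]

theorem sum_push [Fintype α] (p : Ω → ℝ) (X : Ω → α) : ∑ a, push p X a = ∑ ω, p ω := by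
  unfold push
  rw [Finset.sum_comm]
  simp

theorem push_comp [Fintype α] (p : Ω → ℝ) (X : Ω → α) (Y : α → β) :
    push p (fun ω => Y (X ω)) = push (push p X) Y := by
  funext b
  simp only [push, ← Finset.sum_filter]
  rw [Finset.sum_comm' (t' := Finset.univ.filter fun ω => Y (X ω) = b) (s' := fun ω => {X ω})]
  · simp
  · intro a ω
    simp only [mem_filter, mem_univ, true_and, mem_singleton]
    constructor
    · rintro ⟨h, rfl⟩
      exact ⟨rfl, h⟩
    · rintro ⟨rfl, h⟩
      exact ⟨h, rfl⟩

theorem entRV_equiv [Fintype α] [Fintype β] (p : Ω → ℝ) (X : Ω → α) (e : α ≃ β) :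
    entRV p (fun ω => e (X ω)) = entRV p X := by
  have h (a : α) : push p (fun ω => e (X ω)) (e a) = push p X a := by
    simp [push]
  unfold entRV ent
  rw [← e.sum_comp]
  simp only [h]

end Push

theorem mul_logb_mul {c : ℝ} (hc : 0 < c) (x : ℝ) :
    c * x * Real.logb 2 (c * x) = c * (x * Real.logb 2 x) + c * Real.logb 2 c * x := by
  rcases eq_or_ne x 0 with rfl | hx
  · simp
  · rw [Real.logb_mul hc.ne' hx]
    ring

section Mix

variable {T : Type*} {m n : ℕ}

/-- The mixture of `q₁` and `q₂` with weights `a` and `b`, on the disjoint union of the auxiliary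
alphabets. -/
noncomputable def mix (a b : ℝ) (q₁ : Fin m × T → ℝ) (q₂ : Fin n × T → ℝ) :
    Fin (m + n) × T → ℝ :=
  fun x => Fin.addCases (fun i => a * q₁ (i, x.2)) (fun j => b * q₂ (j, x.2)) x.1

@[simp] theorem mix_castAdd (a b : ℝ) (q₁ : Fin m × T → ℝ) (q₂ : Fin n × T → ℝ) (i : Fin m)
    (t : T) : mix a b q₁ q₂ (Fin.castAdd n i, t) = a * q₁ (i, t) := by
  simp [mix]

@[simp] theorem mix_natAdd (a b : ℝ) (q₁ : Fin m × T → ℝ) (q₂ : Fin n × T → ℝ) (j : Fin n)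
    (t : T) : mix a b q₁ q₂ (Fin.natAdd m j, t) = b * q₂ (j, t) := by
  simp [mix]

theorem castAdd_ne_natAdd (i : Fin m) (j : Fin n) : Fin.castAdd n i ≠ Fin.natAdd m j := by
  intro h
  have := congrArg Fin.val h
  simp only [Fin.val_castAdd, Fin.val_natAdd] at this
  omega

theorem sum_fin_add_prod [Fintype T] (F : Fin (m + n) × T → ℝ) :
    ∑ x, F x = ∑ x : Fin m × T, F (Fin.castAdd n x.1, x.2) +
      ∑ x : Fin n × T, F (Fin.natAdd m x.1, x.2) := by
  simp only [Fintype.sum_prod_type, Fin.sum_univ_add]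

variable [Fintype T] {a b : ℝ} {q₁ : Fin m × T → ℝ} {q₂ : Fin n × T → ℝ}

theorem push_mix (X : Fin (m + n) × T → α) (x : α) :
    push (mix a b q₁ q₂) X x = a * push q₁ (fun y => X (Fin.castAdd n y.1, y.2)) x +
      b * push q₂ (fun y => X (Fin.natAdd m y.1, y.2)) x := by
  unfold push
  rw [sum_fin_add_prod]
  simp only [mix_castAdd, mix_natAdd, Finset.mul_sum, mul_ite, mul_zero]

theorem push_mix_left {X : Fin (m + n) × T → α} {X₁ : Fin m × T → β} {x : α} {x₁ : β}
    (h₁ : ∀ i t, X (Fin.castAdd n i, t) = x ↔ X₁ (i, t) = x₁)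
    (h₂ : ∀ j t, X (Fin.natAdd m j, t) ≠ x) :
    push (mix a b q₁ q₂) X x = a * push q₁ X₁ x₁ := by
  rw [push_mix]
  simp [push, h₁, h₂]

theorem push_mix_right {X : Fin (m + n) × T → α} {X₂ : Fin n × T → β} {x : α} {x₂ : β}
    (h₁ : ∀ i t, X (Fin.castAdd n i, t) ≠ x)
    (h₂ : ∀ j t, X (Fin.natAdd m j, t) = x ↔ X₂ (j, t) = x₂) :
    push (mix a b q₁ q₂) X x = b * push q₂ X₂ x₂ := by
  rw [push_mix]
  simp [push, h₁, h₂]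

theorem push_mix_pair_left (Y : T → β) (i : Fin m) (y : β) :
    push (mix a b q₁ q₂) (fun x => (x.1, Y x.2)) (Fin.castAdd n i, y) =
      a * push q₁ (fun x => (x.1, Y x.2)) (i, y) :=
  push_mix_left (by simp) (by simp [(castAdd_ne_natAdd _ _).symm])

theorem push_mix_pair_right (Y : T → β) (j : Fin n) (y : β) :
    push (mix a b q₁ q₂) (fun x => (x.1, Y x.2)) (Fin.natAdd m j, y) =
      b * push q₂ (fun x => (x.1, Y x.2)) (j, y) :=
  push_mix_right (by simp [castAdd_ne_natAdd]) (by simp)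

theorem isPMF_mix (ha : 0 ≤ a) (hb : 0 ≤ b) (hab : a + b = 1) (h₁ : IsPMF q₁) (h₂ : IsPMF q₂) :
    IsPMF (mix a b q₁ q₂) := by
  refine ⟨?_, ?_⟩
  · rintro ⟨i, t⟩
    induction i using Fin.addCases with
    | left i => simpa using mul_nonneg ha (h₁.1 _)
    | right j => simpa using mul_nonneg hb (h₂.1 _)
  · rw [sum_fin_add_prod]
    simp only [mix_castAdd, mix_natAdd, ← Finset.mul_sum, Prod.mk.eta, h₁.2, h₂.2]
    linarith

theorem push_snd_mix {p : T → ℝ} (hab : a + b = 1) (h₁ : push q₁ (fun x => x.2) = p)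
    (h₂ : push q₂ (fun x => x.2) = p) : push (mix a b q₁ q₂) (fun x => x.2) = p := by
  funext t
  rw [push_mix, h₁, h₂, ← add_mul, hab, one_mul]

theorem push_comp_snd {k : ℕ} {p : T → ℝ} {q : Fin k × T → ℝ} (hq : push q (fun x => x.2) = p)
    (F : T → α) : push q (fun x => F x.2) = push p F := by
  rw [push_comp q (fun x => x.2) F, hq]

theorem entRV_comp_snd [Fintype α] {k : ℕ} {p : T → ℝ} {q : Fin k × T → ℝ}
    (hq : push q (fun x => x.2) = p) (F : T → α) :
    entRV q (fun x => F x.2) = entRV p F := by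
  rw [entRV, push_comp_snd hq, entRV]

theorem entRV_mix [Fintype β] (ha : 0 < a) (hb : 0 < b) (h₁ : IsPMF q₁) (h₂ : IsPMF q₂)
    (Y : T → β) :
    entRV (mix a b q₁ q₂) (fun x => (x.1, Y x.2)) =
      a * entRV q₁ (fun x => (x.1, Y x.2)) + b * entRV q₂ (fun x => (x.1, Y x.2)) -
        (a * Real.logb 2 a + b * Real.logb 2 b) := by
  unfold entRV ent
  rw [sum_fin_add_prod]
  simp only [push_mix_pair_left, push_mix_pair_right, mul_logb_mul ha, mul_logb_mul hb,
    Finset.sum_add_distrib, ← Finset.mul_sum, Prod.mk.eta, sum_push, h₁.2, h₂.2]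
  ring

theorem condMI_mix [Fintype α] [Fintype β] {p : T → ℝ} (ha : 0 < a) (hb : 0 < b)
    (hab : a + b = 1) (h₁ : IsPMF q₁) (h₂ : IsPMF q₂) (hp₁ : push q₁ (fun x => x.2) = p)
    (hp₂ : push q₂ (fun x => x.2) = p) (Y : T → α) (Z : T → β) :
    condMI (mix a b q₁ q₂) (fun x => Y x.2) (fun x => x.1) (fun x => Z x.2) =
      a * condMI q₁ (fun x => Y x.2) (fun x => x.1) (fun x => Z x.2) +
        b * condMI q₂ (fun x => Y x.2) (fun x => x.1) (fun x => Z x.2) := by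
  have swap {k : ℕ} (q : Fin k × T → ℝ) :
      entRV q (fun x => (Y x.2, x.1, Z x.2)) = entRV q (fun x => (x.1, Y x.2, Z x.2)) :=
    entRV_equiv q (fun x => (x.1, Y x.2, Z x.2))
      ⟨fun x => (x.2.1, x.1, x.2.2), fun x => (x.2.1, x.1, x.2.2), fun _ => rfl, fun _ => rfl⟩
  have hp := push_snd_mix hab hp₁ hp₂
  unfold condMI
  simp only [swap]
  rw [entRV_mix ha hb h₁ h₂ Z, entRV_mix ha hb h₁ h₂ (fun t => (Y t, Z t)),
    entRV_comp_snd hp Z, entRV_comp_snd hp₁ Z, entRV_comp_snd hp₂ Z,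
    entRV_comp_snd hp (fun t => (Y t, Z t)),
    entRV_comp_snd hp₁ (fun t => (Y t, Z t)), entRV_comp_snd hp₂ (fun t => (Y t, Z t))]
  linear_combination (entRV p Z - entRV p fun t => (Y t, Z t)) * hab

theorem markovChain_mix {p : T → ℝ} (hab : a + b = 1) (hp₁ : push q₁ (fun x => x.2) = p)
    (hp₂ : push q₂ (fun x => x.2) = p) {Y : T → α} {Z : T → β}
    (h₁ : MarkovChain q₁ (fun x => x.1) (fun x => Y x.2) (fun x => Z x.2))
    (h₂ : MarkovChain q₂ (fun x => x.1) (fun x => Y x.2) (fun x => Z x.2)) :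
    MarkovChain (mix a b q₁ q₂) (fun x => x.1) (fun x => Y x.2) (fun x => Z x.2) := by
  have hp := push_snd_mix hab hp₁ hp₂
  intro i y z
  induction i using Fin.addCases with
  | left i =>
    have h := h₁ i y z
    rw [push_comp_snd hp₁ Y, push_comp_snd hp₁ (fun t => (Z t, Y t))] at h
    rw [push_comp_snd hp Y, push_comp_snd hp (fun t => (Z t, Y t)), push_mix_pair_left Y,
      push_mix_pair_left (fun t => (Y t, Z t))]
    linear_combination a * h
  | right j =>
    have h := h₂ j y z
    rw [push_comp_snd hp₂ Y, push_comp_snd hp₂ (fun t => (Z t, Y t))] at h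
    rw [push_comp_snd hp Y, push_comp_snd hp (fun t => (Z t, Y t)), push_mix_pair_right Y,
      push_mix_pair_right (fun t => (Y t, Z t))]
    linear_combination b * h

end Mix

section GacsKorner

variable {T U V : Type*} {m n : ℕ} [Fintype T]

/-- The joint pmf of `(A, Y)` and `(A, Z)`, where `A` is the first coordinate. -/
noncomputable def pairPush {k : ℕ} (q : Fin k × T → ℝ) (Y : T → U) (Z : T → V) :
    (Fin k × U) × (Fin k × V) → ℝ :=
  push q (fun x => ((x.1, Y x.2), (x.1, Z x.2)))

theorem fst_eq_of_pairPush_pos {k : ℕ} {q : Fin k × T → ℝ} {Y : T → U} {Z : T → V}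
    {x : Fin k × U} {y : Fin k × V} (h : 0 < pairPush q Y Z (x, y)) : x.1 = y.1 := by
  obtain ⟨ω, -, hω⟩ := Finset.exists_ne_zero_of_sum_ne_zero h.ne'
  have hω : ((ω.1, Y ω.2), (ω.1, Z ω.2)) = (x, y) := by
    by_contra hne
    exact hω (if_neg hne)
  simp only [Prod.ext_iff] at hω
  exact hω.1.1.symm.trans hω.2.1

theorem fst_eq_of_gkConn {k : ℕ} {q : Fin k × T → ℝ} {Y : T → U} {Z : T → V}
    {y₁ y₂ : Fin k × V} (h : GKConn (pairPush q Y Z) y₁ y₂) : y₁.1 = y₂.1 := by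
  induction h with
  | refl => rfl
  | tail _ hs ih =>
    obtain ⟨x, hx₁, hx₂⟩ := hs
    exact ih.trans ((fst_eq_of_pairPush_pos hx₁).symm.trans (fst_eq_of_pairPush_pos hx₂))

/-- If the joint pmf of `q` restricted along an injection of auxiliary alphabets is a positive
multiple of that of `q'`, then both have the same connectivity relation there. -/
theorem gkConn_embed {k l : ℕ} {q : Fin k × T → ℝ} {q' : Fin l × T → ℝ} {Y : T → U} {Z : T → V}
    {e : Fin l → Fin k} (he : Function.Injective e) {c : ℝ} (hc : 0 < c)
    (h : ∀ i u j v, pairPush q Y Z ((e i, u), (e j, v)) = c * pairPush q' Y Z ((i, u), (j, v)))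
    (y₁ y₂ : Fin l × V) :
    GKConn (pairPush q Y Z) (e y₁.1, y₁.2) (e y₂.1, y₂.2) ↔
      GKConn (pairPush q' Y Z) y₁ y₂ := by
  have pos (x : Fin l × U) (y : Fin l × V) :
      0 < pairPush q Y Z ((e x.1, x.2), (e y.1, y.2)) ↔ 0 < pairPush q' Y Z (x, y) := by
    rw [h, mul_pos_iff_of_pos_left hc]
  constructor
  · suffices H : ∀ w, GKConn (pairPush q Y Z) (e y₁.1, y₁.2) w →
        ∀ y : Fin l × V, w = (e y.1, y.2) → GKConn (pairPush q' Y Z) y₁ y from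
      fun hw => H _ hw y₂ rfl
    intro w hw
    induction hw with
    | refl =>
      intro y hy
      obtain rfl : y₁ = y := Prod.ext (he (Prod.ext_iff.1 hy).1) (Prod.ext_iff.1 hy).2
      exact .refl
    | @tail w w' hw hs ih =>
      rintro y rfl
      obtain ⟨⟨i, u⟩, hx₁, hx₂⟩ := hs
      obtain rfl : i = e y.1 := fst_eq_of_pairPush_pos hx₂
      obtain ⟨i', v⟩ := w
      obtain rfl : e y.1 = i' := fst_eq_of_pairPush_pos hx₁
      exact (ih (y.1, v) rfl).tail ⟨(y.1, u), (pos _ (y.1, v)).1 hx₁, (pos (y.1, u) _).1 hx₂⟩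
  · intro hw
    induction hw with
    | refl => exact .refl
    | tail _ hs ih =>
      obtain ⟨x, hx₁, hx₂⟩ := hs
      exact ih.tail ⟨(e x.1, x.2), (pos _ _).2 hx₁, (pos _ _).2 hx₂⟩

/-- The function on a disjoint union of alphabets acting as `g₁` and `g₂` on the two parts. -/
def glue (g₁ : Fin m × V → Fin m × V) (g₂ : Fin n × V → Fin n × V) (y : Fin (m + n) × V) :
    Fin (m + n) × V :=
  Fin.addCases (fun i => (Fin.castAdd n (g₁ (i, y.2)).1, (g₁ (i, y.2)).2))
    (fun j => (Fin.natAdd m (g₂ (j, y.2)).1, (g₂ (j, y.2)).2)) y.1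

@[simp] theorem glue_castAdd (g₁ : Fin m × V → Fin m × V) (g₂ : Fin n × V → Fin n × V)
    (i : Fin m) (v : V) :
    glue g₁ g₂ (Fin.castAdd n i, v) = (Fin.castAdd n (g₁ (i, v)).1, (g₁ (i, v)).2) := by
  simp [glue]

@[simp] theorem glue_natAdd (g₁ : Fin m × V → Fin m × V) (g₂ : Fin n × V → Fin n × V)
    (j : Fin n) (v : V) :
    glue g₁ g₂ (Fin.natAdd m j, v) = (Fin.natAdd m (g₂ (j, v)).1, (g₂ (j, v)).2) := by
  simp [glue]

theorem isGKMap_mix {a b : ℝ} (ha : 0 < a) (hb : 0 < b) {q₁ : Fin m × T → ℝ}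
    {q₂ : Fin n × T → ℝ} {Y : T → U} {Z : T → V} {g₁ : Fin m × V → Fin m × V}
    {g₂ : Fin n × V → Fin n × V} (h₁ : IsGKMap (pairPush q₁ Y Z) g₁)
    (h₂ : IsGKMap (pairPush q₂ Y Z) g₂) :
    IsGKMap (pairPush (mix a b q₁ q₂) Y Z) (glue g₁ g₂) := by
  rintro ⟨i, v⟩ ⟨j, w⟩
  have ne (i : Fin m) (j : Fin n) := castAdd_ne_natAdd i j
  induction i using Fin.addCases with
  | left i =>
    induction j using Fin.addCases with
    | left j =>
      rw [gkConn_embed (Fin.castAdd_injective m n) ha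
        (fun _ _ _ _ => push_mix_left (by simp) (by simp [(ne _ _).symm])) (i, v) (j, w),
        ← h₁]
      simp [Prod.ext_iff]
    | right j =>
      refine iff_of_false (fun h => ne (g₁ (i, v)).1 (g₂ (j, w)).1 ?_)
        (fun h => ne _ _ (fst_eq_of_gkConn h))
      simpa using congrArg Prod.fst h
  | right i =>
    induction j using Fin.addCases with
    | left j =>
      refine iff_of_false (fun h => ne (g₁ (j, w)).1 (g₂ (i, v)).1 ?_)
        (fun h => ne _ _ (fst_eq_of_gkConn h).symm)
      simpa using (congrArg Prod.fst h).symm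
    | right j =>
      rw [gkConn_embed (Fin.natAdd_injective n m) hb
        (fun _ _ _ _ => push_mix_right (by simp [ne]) (by simp)) (i, v) (j, w), ← h₂]
      simp [Prod.ext_iff]

end GacsKorner

theorem PStar.mix {S U V W : Type*} [Fintype S] [Fintype U] [Fintype V]
    {p : S × U × V → ℝ} {d : S → W → ℝ} {D a b : ℝ} {m n : ℕ} {q₁ : Fin m × S × U × V → ℝ}
    {q₂ : Fin n × S × U × V → ℝ} (ha : 0 < a) (hb : 0 < b) (hab : a + b = 1)
    (h₁ : PStar p d D m q₁) (h₂ : PStar p d D n q₂) :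
    PStar p d D (m + n) (CRR.mix a b q₁ q₂) := by
  obtain ⟨hq₁, hp₁, hM₁, g₁, f₁, hg₁, hD₁⟩ := h₁
  obtain ⟨hq₂, hp₂, hM₂, g₂, f₂, hg₂, hD₂⟩ := h₂
  refine ⟨isPMF_mix ha.le hb.le hab hq₁ hq₂,
    fun y => congrFun (push_snd_mix hab (funext hp₁) (funext hp₂)) y,
    markovChain_mix hab (funext hp₁) (funext hp₂) (Y := fun t : S × U × V => t.1)
      (Z := fun t => t.2) hM₁ hM₂,
    glue g₁ g₂, fun y => Fin.addCases (fun i => f₁ (i, y.2)) (fun j => f₂ (j, y.2)) y.1,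
    isGKMap_mix ha hb (Y := fun t : S × U × V => t.2.1) (Z := fun t => t.2.2) hg₁ hg₂, ?_⟩
  unfold expVal at *
  rw [sum_fin_add_prod]
  simp only [mix_castAdd, mix_natAdd, glue_castAdd, glue_natAdd, Fin.addCases_left,
    Fin.addCases_right, Prod.mk.eta, mul_assoc, ← Finset.mul_sum]
  calc _ ≤ a * D + b * D := by gcongr
    _ = D := by rw [← add_mul, hab, one_mul]

/-- Lemma 7: the region ℛ*(D) = ⋃_k ℛ*_k(D) is a convex subset of [0,∞)². -/
theorem stmt7 {S U V W : Type*} [Fintype S] [Fintype U] [Fintype V] [Fintype W]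
    (p : S × U × V → ℝ) (hp : IsPMF p) (Dbar : ℝ) (hDbar : 0 < Dbar)
    (d : S → W → ℝ) (hd : ∀ s w, 0 ≤ d s w ∧ d s w ≤ Dbar)
    (D : ℝ) (hD : 0 ≤ D) :
    Convex ℝ (⋃ k : ℕ, RStar p d D k) ∧
    (⋃ k : ℕ, RStar p d D k) ⊆ {r : ℝ × ℝ | 0 ≤ r.1 ∧ 0 ≤ r.2} := by
  refine ⟨convex_iff_forall_pos.2 ?_, ?_⟩
  · intro r hr r' hr' a b ha hb hab
    obtain ⟨m, hr₁, hr₂, q₁, hq₁, hU₁, hV₁⟩ := Set.mem_iUnion.1 hr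
    obtain ⟨n, hr₁', hr₂', q₂, hq₂, hU₂, hV₂⟩ := Set.mem_iUnion.1 hr'
    refine Set.mem_iUnion.2 ⟨m + n, ?_, ?_, mix a b q₁ q₂, hq₁.mix ha hb hab hq₂, ?_, ?_⟩
    · simp only [Prod.fst_add, Prod.smul_fst, smul_eq_mul]
      positivity
    · simp only [Prod.snd_add, Prod.smul_snd, smul_eq_mul]
      positivity
    · simp only [Prod.fst_add, Prod.smul_fst, smul_eq_mul]
      rw [condMI_mix ha hb hab hq₁.1 hq₂.1 (funext hq₁.2.1) (funext hq₂.2.1)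
        (fun t : S × U × V => t.1) (fun t => t.2.1)]
      gcongr
    · simp only [Prod.fst_add, Prod.smul_fst, Prod.snd_add, Prod.smul_snd, smul_eq_mul]
      rw [condMI_mix ha hb hab hq₁.1 hq₂.1 (funext hq₁.2.1) (funext hq₂.2.1)
        (fun t : S × U × V => t.1) (fun t => t.2.2)]
      linarith [mul_le_mul_of_nonneg_left hV₁ ha.le, mul_le_mul_of_nonneg_left hV₂ hb.le]
  · intro r hr
    obtain ⟨k, h₁, h₂, -⟩ := Set.mem_iUnion.1 hr
    exact ⟨h₁, h₂⟩

end CRR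
end

section
/- Fix k ∈ ℕ. For each i ∈ ℕ let D_i ∈ [D̲, D̄] and let (r_uv^{(i)}, r_v^{(i)}) ∈ ℛ*_k(D_i). If D_i → 𝖣 and (r_uv^{(i)}, r_v^{(i)}) → (𝗋_uv, 𝗋_v) as i → ∞, then (𝗋_uv, 𝗋_v) ∈ ℛ*_k(𝖣). In particular (taking D_i = D for all i), ℛ*_k(D) is a topologically closed subset of ℝ² for every D ∈ [D̲, D̄]. -/
open Finset

namespace CRR

open scoped Classical

variable {Ω α β γ : Type*}

theorem continuous_push [Fintype Ω] (X : Ω → α) (a : α) :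
    Continuous fun p : Ω → ℝ => push p X a := by
  unfold push
  refine continuous_finsetSum _ fun ω _ => ?_
  split_ifs <;> fun_prop

theorem continuous_entRV [Fintype Ω] [Fintype α] (X : Ω → α) :
    Continuous fun p : Ω → ℝ => entRV p X := by
  unfold entRV ent
  refine (continuous_finsetSum _ fun a _ => ?_).neg
  simp only [Real.logb, mul_div_assoc']
  exact (Real.continuous_mul_log.comp (continuous_push X a)).div_const _

theorem continuous_condMI [Fintype Ω] [Fintype α] [Fintype β] [Fintype γ]
    (X : Ω → α) (Y : Ω → β) (Z : Ω → γ) :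
    Continuous fun p : Ω → ℝ => condMI p X Y Z :=
  (((continuous_entRV _).add (continuous_entRV _)).sub (continuous_entRV _)).sub
    (continuous_entRV _)

theorem continuous_expVal [Fintype Ω] (f : Ω → ℝ) :
    Continuous fun p : Ω → ℝ => expVal p f := by
  unfold expVal
  fun_prop

theorem isClosed_markovChain [Fintype Ω] (X : Ω → α) (Y : Ω → β) (Z : Ω → γ) :
    IsClosed {p : Ω → ℝ | MarkovChain p X Y Z} := by
  simp only [MarkovChain, Set.ofPred_forall]
  exact isClosed_iInter fun x => isClosed_iInter fun y => isClosed_iInter fun z =>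
    isClosed_eq ((continuous_push _ _).mul (continuous_push _ _))
      ((continuous_push _ _).mul (continuous_push _ _))

/-- `F` is constant on the connected components of the bipartite graph of `p`. -/
def ConstOnComponents {δ : Type*} (p : α × β → ℝ) (F : β → δ) : Prop :=
  ∀ y₁ y₂, GKStep p y₁ y₂ → F y₁ = F y₂

theorem ConstOnComponents.eq_of_gkConn {δ : Type*} {p : α × β → ℝ} {F : β → δ}
    (hF : ConstOnComponents p F) {y₁ y₂ : β} (h : GKConn p y₁ y₂) : F y₁ = F y₂ := by
  induction h with
  | refl => rfl
  | tail _ hs ih => exact ih.trans (hF _ _ hs)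

theorem isClosed_constOnComponents {δ : Type*} [Fintype Ω] (X : Ω → α × β) (F : β → δ) :
    IsClosed {p : Ω → ℝ | ConstOnComponents (push p X) F} := by
  have h : {p : Ω → ℝ | ConstOnComponents (push p X) F} =
      ⋂ (y₁ : β) (y₂ : β) (x : α) (_ : F y₁ ≠ F y₂),
        {p | push p X (x, y₁) ≤ 0} ∪ {p | push p X (x, y₂) ≤ 0} := by
    ext p
    simp only [Set.mem_ofPred_eq, Set.mem_iInter, Set.mem_union, ConstOnComponents, GKStep]
    constructor
    · intro hp y₁ y₂ x hne
      by_contra! hpos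
      exact hne (hp y₁ y₂ ⟨x, hpos⟩)
    · rintro hp y₁ y₂ ⟨x, h₁, h₂⟩
      by_contra hne
      rcases hp y₁ y₂ x hne with h | h <;> linarith
  rw [h]
  exact isClosed_iInter fun y₁ => isClosed_iInter fun y₂ => isClosed_iInter fun x =>
    isClosed_iInter fun _ => (isClosed_le (continuous_push _ _) continuous_const).union
      (isClosed_le (continuous_push _ _) continuous_const)

theorem gkConn_symm {p : α × β → ℝ} {y₁ y₂ : β} (h : GKConn p y₁ y₂) : GKConn p y₂ y₁ :=
  have : Std.Symm (GKStep p) := ⟨fun _ _ ⟨x, h₁, h₂⟩ => ⟨x, h₂, h₁⟩⟩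
  Relation.ReflTransGen.stdSymm.symm _ _ h

theorem exists_isGKMap (p : α × β → ℝ) :
    ∃ g : β → β, IsGKMap p g ∧ ∀ y, GKConn p (g y) y := by
  let s : Setoid β := ⟨GKConn p, fun _ => .refl, gkConn_symm, .trans⟩
  refine ⟨fun y => (Quotient.mk s y).out, fun y₁ y₂ => ?_, fun y => Quotient.mk_out (s := s) y⟩
  exact Quotient.out_inj.trans (Quotient.eq (r := s))

/-- Reconstructions from the Gács–Körner common randomness are exactly the functions that are
constant on connected components. -/
theorem exists_isGKMap_comp_iff {δ : Type*} (p : α × β → ℝ) (P : (β → δ) → Prop) :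
    (∃ (g : β → β) (f : β → δ), IsGKMap p g ∧ P fun y => f (g y)) ↔
      ∃ F : β → δ, ConstOnComponents p F ∧ P F := by
  constructor
  · rintro ⟨g, f, hg, hP⟩
    exact ⟨_, fun y₁ y₂ h => congrArg f ((hg y₁ y₂).2 (.single h)), hP⟩
  · rintro ⟨F, hF, hP⟩
    obtain ⟨g, hg, hgy⟩ := exists_isGKMap p
    refine ⟨g, F, hg, ?_⟩
    rwa [show (fun y => F (g y)) = F from funext fun y => hF.eq_of_gkConn (hgy y)]

section RateRegions

variable {S U V W : Type*} [Fintype S] [Fintype U] [Fintype V] [Fintype W]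

theorem isClosed_setOf_pStar (p : S × U × V → ℝ) (d : S → W → ℝ) (k : ℕ) :
    IsClosed {z : (Fin k × S × U × V → ℝ) × ℝ | PStar p d z.2 k z.1} := by
  have h : {z : (Fin k × S × U × V → ℝ) × ℝ | PStar p d z.2 k z.1} =
      (Prod.fst ⁻¹' stdSimplex ℝ (Fin k × S × U × V)) ∩
      ((⋂ y, {z | push z.1 (fun x => x.2) y = p y}) ∩
      ((Prod.fst ⁻¹' {q | MarkovChain q (fun x => x.1) (fun x => x.2.1) (fun x => x.2.2)}) ∩
      ⋃ F : Fin k × V → W,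
        (Prod.fst ⁻¹' {q | ConstOnComponents
          (push q (fun x => ((x.1, x.2.2.1), (x.1, x.2.2.2)))) F}) ∩
        {z | expVal z.1 (fun x => d x.2.1 (F (x.1, x.2.2.2))) ≤ z.2})) := by
    ext z
    have hF := exists_isGKMap_comp_iff (push z.1 (fun x => ((x.1, x.2.2.1), (x.1, x.2.2.2))))
      (fun F : Fin k × V → W => expVal z.1 (fun x => d x.2.1 (F (x.1, x.2.2.2))) ≤ z.2)
    simp only [Set.mem_inter_iff, Set.mem_iInter, Set.mem_iUnion, Set.mem_preimage,
      Set.mem_ofPred_eq, PStar, hF]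
    rfl
  rw [h]
  refine ((isClosed_stdSimplex _ _).preimage continuous_fst).inter
    ((isClosed_iInter fun y =>
      isClosed_eq ((continuous_push _ _).comp continuous_fst) continuous_const).inter
    (((isClosed_markovChain _ _ _).preimage continuous_fst).inter
    (isClosed_iUnion_of_finite fun F =>
      ((isClosed_constOnComponents _ F).preimage continuous_fst).inter
      (isClosed_le ((continuous_expVal _).comp continuous_fst) continuous_snd))))

theorem mem_rStar_of_tendsto (p : S × U × V → ℝ) (d : S → W → ℝ) (k : ℕ)
    {Dseq : ℕ → ℝ} {r : ℕ → ℝ × ℝ} {D : ℝ} {r₀ : ℝ × ℝ}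
    (hr : ∀ i, r i ∈ RStar p d (Dseq i) k)
    (hD : Filter.Tendsto Dseq Filter.atTop (nhds D))
    (hr₀ : Filter.Tendsto r Filter.atTop (nhds r₀)) : r₀ ∈ RStar p d D k := by
  choose h₁ h₂ q hq hI₁ hI₂ using hr
  obtain ⟨q₀, -, φ, hφ, hq₀⟩ :=
    (isCompact_stdSimplex ℝ (Fin k × S × U × V)).tendsto_subseq (x := q) fun i => (hq i).1
  have hrφ₁ := (continuous_fst.tendsto r₀).comp hr₀
  have hrφ₂ := (continuous_snd.tendsto r₀).comp hr₀
  have hφt := hφ.tendsto_atTop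
  refine ⟨ge_of_tendsto' hrφ₁ h₁, ge_of_tendsto' hrφ₂ h₂, q₀, ?_, ?_, ?_⟩
  · exact (isClosed_setOf_pStar p d k).mem_of_tendsto (hq₀.prodMk_nhds (hD.comp hφt))
      (Filter.Eventually.of_forall fun i => hq (φ i))
  · exact le_of_tendsto_of_tendsto' (((continuous_condMI _ _ _).tendsto q₀).comp hq₀)
      (hrφ₁.comp hφt) fun i => hI₁ (φ i)
  · exact le_of_tendsto_of_tendsto' (((continuous_condMI _ _ _).tendsto q₀).comp hq₀)
      ((hrφ₂.add hrφ₁).comp hφt) fun i => hI₂ (φ i)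

end RateRegions

/-- Lemma 8: if Dᵢ ∈ [D̲,D̄], (r_uv⁽ⁱ⁾,r_v⁽ⁱ⁾) ∈ ℛ*_k(Dᵢ), Dᵢ → 𝖣 and
(r_uv⁽ⁱ⁾,r_v⁽ⁱ⁾) → (𝗋_uv,𝗋_v), then (𝗋_uv,𝗋_v) ∈ ℛ*_k(𝖣); in particular ℛ*_k(D) is
closed for every D ∈ [D̲,D̄]. -/
theorem stmt8 {S U V W : Type*} [Fintype S] [Fintype U] [Fintype V] [Fintype W] [Nonempty W]
    (p : S × U × V → ℝ) (hp : IsPMF p) (Dbar : ℝ) (hDbar : 0 < Dbar)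
    (d : S → W → ℝ) (hd : ∀ s w, 0 ≤ d s w ∧ d s w ≤ Dbar)
    (k : ℕ) :
    (∀ (Dseq : ℕ → ℝ) (r : ℕ → ℝ × ℝ) (DD : ℝ) (rr : ℝ × ℝ),
      (∀ i, (⨅ φ : S → W, expVal p (fun x => d x.1 (φ x.1))) ≤ Dseq i ∧ Dseq i ≤ Dbar) →
      (∀ i, r i ∈ RStar p d (Dseq i) k) →
      Filter.Tendsto Dseq Filter.atTop (nhds DD) →
      Filter.Tendsto r Filter.atTop (nhds rr) →
      rr ∈ RStar p d DD k) ∧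
    (∀ D : ℝ, (⨅ φ : S → W, expVal p (fun x => d x.1 (φ x.1))) ≤ D → D ≤ Dbar →
      IsClosed (RStar p d D k)) := by
  refine ⟨fun Dseq r DD rr _ hr hD hrr => mem_rStar_of_tendsto p d k hr hD hrr,
    fun D _ _ => ?_⟩
  exact IsSeqClosed.isClosed fun r r₀ hr hr₀ =>
    mem_rStar_of_tendsto p d k hr tendsto_const_nhds hr₀

end CRR
end
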